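/- Let ω₀, r, ξ be real numbers with ω₀ > 0, r > 0, r ≠ 1 and 0 < ξ ≤ 1, and set β = 2ξ² − 1. If (ω, γ) is a real pair satisfying n(ω, γ) = 0 and (∂n/∂ω)(ω, γ) = 0, then ω·F₁(ω) = 0, where F₁(ω) = βω⁴ + ω₀²(r² + 1)ω² + r²ω₀⁴β. -/

import Mathlib

/-- The bivariate polynomial
`n(ω, γ) = (γ² − r⁴)ω⁴ + 2r²ω₀²β(γ² − r²)ω² + r⁴ω₀⁴(γ² − 1)`. -/
def nPoly (ω₀ r β : ℝ) (ω γ : ℝ) : ℝ :=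
  (γ ^ 2 - r ^ 4) * ω ^ 4 + 2 * r ^ 2 * ω₀ ^ 2 * β * (γ ^ 2 - r ^ 2) * ω ^ 2 +
    r ^ 4 * ω₀ ^ 4 * (γ ^ 2 - 1)

theorem hasDerivAt_nPoly (ω₀ r β ω γ : ℝ) :
    HasDerivAt (fun w => nPoly ω₀ r β w γ)
      ((γ ^ 2 - r ^ 4) * (4 * ω ^ 3) + 2 * r ^ 2 * ω₀ ^ 2 * β * (γ ^ 2 - r ^ 2) * (2 * ω)) ω := by
  simpa [nPoly] using (((hasDerivAt_pow 4 ω).const_mul (γ ^ 2 - r ^ 4)).add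
    ((hasDerivAt_pow 2 ω).const_mul (2 * r ^ 2 * ω₀ ^ 2 * β * (γ ^ 2 - r ^ 2)))).add_const
      (r ^ 4 * ω₀ ^ 4 * (γ ^ 2 - 1))

/-- Any real common solution `(ω, γ)` of `n = 0` and `∂n/∂ω = 0` satisfies
`ω·F₁(ω) = 0` where `F₁(ω) = βω⁴ + ω₀²(r²+1)ω² + r²ω₀⁴β`. -/
theorem critical_points_satisfy_omega_resultant (ω₀ r ξ β : ℝ)
    (hω₀ : 0 < ω₀) (hr : 0 < r) (hr1 : r ≠ 1) (hξ₁ : 0 < ξ) (hξ₂ : ξ ≤ 1)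
    (hβ : β = 2 * ξ ^ 2 - 1)
    (ω γ : ℝ) (h₁ : nPoly ω₀ r β ω γ = 0)
    (h₂ : deriv (fun w => nPoly ω₀ r β w γ) ω = 0) :
    ω * (β * ω ^ 4 + ω₀ ^ 2 * (r ^ 2 + 1) * ω ^ 2 + r ^ 2 * ω₀ ^ 4 * β) = 0 := by
  rw [(hasDerivAt_nPoly ω₀ r β ω γ).deriv] at h₂
  unfold nPoly at h₁
  have hr2 : r ^ 2 - 1 ≠ 0 := fun h => hr1 <| by nlinarith
  have hc : 4 * r ^ 4 * ω₀ ^ 2 * (r ^ 2 - 1) ≠ 0 := by positivity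
  refine (mul_eq_zero.mp ?_).resolve_left hc
  linear_combination
    2 * ω * (2 * ω ^ 2 + 2 * r ^ 2 * ω₀ ^ 2 * β) * h₁ -
      (ω ^ 4 + 2 * r ^ 2 * ω₀ ^ 2 * β * ω ^ 2 + r ^ 4 * ω₀ ^ 4) * h₂
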